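/- For every ε > 0 there exists an integer N such that for all finite simple graphs G₁ and G₂ with Hadwiger numbers η(G₁) = h and η(G₂) = l satisfying h ≥ l ≥ N, the Hadwiger number of their Cartesian product satisfies η(G₁ □ G₂) ≥ (1 − ε) · h · √l. -/

import Mathlib

open SimpleGraph

/-- `H` is a minor of `G`: there is a family of branch sets in `G`, one for each vertex of `H`,
which are pairwise disjoint, each inducing a connected subgraph of `G`, such that every edge of
`H` is witnessed by an edge of `G` between the corresponding branch sets. -/
def SimpleGraph.IsMinorOf {W V : Type*} (H : SimpleGraph W) (G : SimpleGraph V) : Prop :=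
  ∃ f : W → Set V,
    (∀ w, (G.induce (f w)).Connected) ∧
    (Pairwise fun w w' => Disjoint (f w) (f w')) ∧
    ∀ ⦃w w'⦄, H.Adj w w' → ∃ u ∈ f w, ∃ v ∈ f w', G.Adj u v

/-- The Hadwiger number of `G`: the largest `n` such that `K_n` is a minor of `G`. -/
noncomputable def SimpleGraph.hadwigerNumber {V : Type*} (G : SimpleGraph V) : ℕ :=
  sSup {n : ℕ | (⊤ : SimpleGraph (Fin n)).IsMinorOf G}

namespace SimpleGraph

variable {U V W : Type*}

lemma connected_induce_of_center {G : SimpleGraph V} {s : Set V} {v : V} (hv : v ∈ s)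
    (h : ∀ u (hu : u ∈ s), (G.induce s).Reachable ⟨v, hv⟩ ⟨u, hu⟩) : (G.induce s).Connected :=
  (connected_iff_exists_forall_reachable _).2 ⟨⟨v, hv⟩, fun u => h u.1 u.2⟩

lemma IsMinorOf.trans {H : SimpleGraph U} {K : SimpleGraph W} {G : SimpleGraph V}
    (h₁ : H.IsMinorOf K) (h₂ : K.IsMinorOf G) : H.IsMinorOf G := by
  obtain ⟨f, fc, fd, fa⟩ := h₁
  obtain ⟨g, gc, gd, ga⟩ := h₂
  refine ⟨fun u => ⋃ w ∈ f u, g w, fun u => ?_, fun u u' huu' => ?_, fun u u' huu' => ?_⟩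
  · have hsub : ∀ w (_ : w ∈ f u), g w ⊆ ⋃ w ∈ f u, g w :=
      fun w hw => Set.subset_biUnion_of_mem hw
    have same : ∀ w (hw : w ∈ f u) a (ha : a ∈ g w) b (hb : b ∈ g w),
        (G.induce (⋃ w ∈ f u, g w)).Reachable ⟨a, hsub w hw ha⟩ ⟨b, hsub w hw hb⟩ :=
      fun w hw a ha b hb =>
        ((gc w).preconnected ⟨a, ha⟩ ⟨b, hb⟩).map (induceHomOfLE G (hsub w hw)).toHom
    have key : ∀ w w' : f u, (K.induce (f u)).Walk w w' →
        ∀ a (ha : a ∈ g w) b (hb : b ∈ g w'),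
        (G.induce (⋃ w ∈ f u, g w)).Reachable ⟨a, hsub w w.2 ha⟩ ⟨b, hsub w' w'.2 hb⟩ := by
      intro w w' p
      induction p with
      | nil => exact fun a ha b hb => same _ (Subtype.prop _) a ha b hb
      | @cons x y z hxy p ih =>
        intro a ha b hb
        obtain ⟨c, hc, d, hd, hcd⟩ := ga (show K.Adj x y from hxy)
        have hadj : (G.induce (⋃ w ∈ f u, g w)).Adj ⟨c, hsub x x.2 hc⟩ ⟨d, hsub y y.2 hd⟩ := hcd
        exact ((same x x.2 a ha c hc).trans hadj.reachable).trans (ih d hd b hb)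
    obtain ⟨w, hw⟩ := (fc u).nonempty
    obtain ⟨a, ha⟩ := (gc w).nonempty
    refine connected_induce_of_center (hsub w hw ha) fun b hb => ?_
    obtain ⟨w', hw', hb'⟩ := Set.mem_iUnion₂.1 hb
    obtain ⟨p⟩ := (fc u).preconnected ⟨w, hw⟩ ⟨w', hw'⟩
    exact key _ _ p a ha b hb'
  · simp only [Set.disjoint_iUnion_left, Set.disjoint_iUnion_right]
    intro w hw w' hw'
    apply gd
    rintro rfl
    exact Set.disjoint_left.1 (fd huu') (by assumption) (by assumption)
  · obtain ⟨w, hw, w', hw', hadj⟩ := fa huu'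
    obtain ⟨a, ha, b, hb, hab⟩ := ga hadj
    exact ⟨a, Set.mem_biUnion hw ha, b, Set.mem_biUnion hw' hb, hab⟩

lemma IsMinorOf.boxProd {U' V' : Type*} {H : SimpleGraph U} {G : SimpleGraph V}
    {H' : SimpleGraph U'} {G' : SimpleGraph V'}
    (h : H.IsMinorOf G) (h' : H'.IsMinorOf G') : (H □ H').IsMinorOf (G □ G') := by
  obtain ⟨f, fc, fd, fa⟩ := h
  obtain ⟨g, gc, gd, ga⟩ := h'
  refine ⟨fun p => f p.1 ×ˢ g p.2, fun p => ?_, fun p q hpq => ?_, fun p q hpq => ?_⟩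
  · let φ : (G.induce (f p.1) □ G'.induce (g p.2)) →g (G □ G').induce (f p.1 ×ˢ g p.2) :=
      { toFun := fun x => ⟨(x.1, x.2), x.1.2, x.2.2⟩
        map_rel' := by
          intro x y hxy
          simpa [boxProd_adj, Subtype.ext_iff] using hxy }
    refine ((fc p.1).boxProd (gc p.2)).map φ ?_
    rintro ⟨⟨a, b⟩, ha, hb⟩
    exact ⟨(⟨a, ha⟩, ⟨b, hb⟩), rfl⟩
  · refine Set.disjoint_prod.2 ?_
    by_cases h1 : p.1 = q.1
    · exact Or.inr (gd fun h2 => hpq (Prod.ext h1 h2))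
    · exact Or.inl (fd h1)
  · obtain ⟨p1, p2⟩ := p
    obtain ⟨q1, q2⟩ := q
    rcases (boxProd_adj.1 hpq) with ⟨h1, h2⟩ | ⟨h1, h2⟩
    · obtain ⟨a, ha, b, hb, hab⟩ := fa h1
      obtain ⟨c, hc⟩ := (gc p2).nonempty
      exact ⟨(a, c), ⟨ha, hc⟩, (b, c), ⟨hb, by simpa [← show p2 = q2 from h2] using hc⟩,
        boxProd_adj.2 (Or.inl ⟨hab, rfl⟩)⟩
    · obtain ⟨a, ha, b, hb, hab⟩ := ga h1
      obtain ⟨c, hc⟩ := (fc p1).nonempty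
      exact ⟨(c, a), ⟨hc, ha⟩, (c, b), ⟨by simpa [← show p1 = q1 from h2] using hc, hb⟩,
        boxProd_adj.2 (Or.inr ⟨hab, rfl⟩)⟩

lemma IsMinorOf.of_embedding {H : SimpleGraph V} (e : U ↪ W)
    (h : (⊤ : SimpleGraph W).IsMinorOf H) : (⊤ : SimpleGraph U).IsMinorOf H := by
  obtain ⟨f, fc, fd, fa⟩ := h
  exact ⟨f ∘ e, fun u => fc _, fun u u' h => fd (e.injective.ne h),
    fun u u' h => fa (e.injective.ne h)⟩

lemma bddAbove_top_isMinorOf [Finite V] (G : SimpleGraph V) :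
    BddAbove {n : ℕ | (⊤ : SimpleGraph (Fin n)).IsMinorOf G} := by
  refine ⟨Nat.card V, ?_⟩
  rintro n ⟨f, fc, fd, -⟩
  choose g hg using fun i => Set.nonempty_coe_sort.1 (fc i).nonempty
  have hinj : Function.Injective g := by
    intro i j hij
    by_contra hne
    exact Set.disjoint_left.1 (fd hne) (hg i) (hij ▸ hg j)
  simpa using Nat.card_le_card_of_injective g hinj

lemma top_isMinorOf_of_card_le_hadwigerNumber [Finite V] [Fintype U] (G : SimpleGraph V)
    (h : Fintype.card U ≤ G.hadwigerNumber) : (⊤ : SimpleGraph U).IsMinorOf G := by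
  have hmem : G.hadwigerNumber ∈ {n : ℕ | (⊤ : SimpleGraph (Fin n)).IsMinorOf G} :=
    Nat.sSup_mem ⟨0, fun i => i.elim0, fun i => i.elim0, fun i => i.elim0, fun i => i.elim0⟩
      (bddAbove_top_isMinorOf G)
  have hcard : Fintype.card U ≤ Fintype.card (Fin G.hadwigerNumber) := by simpa using h
  exact IsMinorOf.of_embedding (Function.Embedding.nonempty_of_card_le hcard).some hmem

lemma IsMinorOf.card_le_hadwigerNumber [Finite V] [Fintype U] {G : SimpleGraph V}
    (h : (⊤ : SimpleGraph U).IsMinorOf G) : Fintype.card U ≤ G.hadwigerNumber :=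
  le_csSup (bddAbove_top_isMinorOf G) (h.of_embedding (Fintype.equivFin U).symm.toEmbedding)

/-- Columns are grouped into `B` copies of `J`; a row `r : R` is coloured by `F r` in each copy,
and a row `c : C` is coloured constantly by `c`. Each colour in each copy is a branch set. -/
lemma top_prod_isMinorOf_boxProd {B J R C : Type*} [Nonempty J] (F : R → J → C)
    (hF : ∀ c c', ∃ r j j', F r j = c ∧ F r j' = c') :
    (⊤ : SimpleGraph (B × C)).IsMinorOf
      ((⊤ : SimpleGraph (B × J)) □ (⊤ : SimpleGraph (R ⊕ C))) := by
  let color : (B × J) × (R ⊕ C) → B × C := fun p =>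
    (p.1.1, Sum.elim (fun r => F r p.1.2) id p.2)
  refine ⟨fun q => color ⁻¹' {q}, fun q => ?_, fun q q' h => ?_, fun q q' h => ?_⟩
  · obtain ⟨b, c⟩ := q
    have hrow : ∀ j, ((b, j), Sum.inr c) ∈ color ⁻¹' {(b, c)} := fun j => rfl
    let j₀ : J := Classical.arbitrary J
    have hreach : ∀ j, (induce (color ⁻¹' {(b, c)})
        ((⊤ : SimpleGraph (B × J)) □ (⊤ : SimpleGraph (R ⊕ C)))).Reachable
        ⟨_, hrow j₀⟩ ⟨_, hrow j⟩ := by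
      intro j
      by_cases h : j₀ = j
      · subst h; exact Reachable.refl _
      · apply Adj.reachable
        simp [boxProd_adj, h]
    refine connected_induce_of_center (hrow j₀) ?_
    rintro ⟨⟨b', j⟩, r | c'⟩ hu
    · have hu' : b' = b ∧ F r j = c := by simpa [color] using hu
      obtain ⟨rfl, -⟩ := hu'
      refine (hreach j).trans (Adj.reachable ?_)
      simp [boxProd_adj]
    · have hu' : b' = b ∧ c' = c := by simpa [color] using hu
      obtain ⟨rfl, rfl⟩ := hu'
      exact hreach j
  · exact Disjoint.preimage _ (Set.disjoint_singleton.2 h)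
  · obtain ⟨b, c⟩ := q
    obtain ⟨b', c'⟩ := q'
    obtain ⟨r, j, j', hj, hj'⟩ := hF c c'
    refine ⟨((b, j), Sum.inl r), by simp [color, hj], ((b', j'), Sum.inl r),
      by simp [color, hj'], ?_⟩
    have hne : (b, j) ≠ (b', j') := by
      rintro heq
      obtain ⟨rfl, rfl⟩ := Prod.mk.inj heq
      exact h (by rw [← hj, ← hj'])
    exact boxProd_adj.2 (Or.inl ⟨hne, rfl⟩)

end SimpleGraph

lemma ZMod.isUnit_natCast_sub_natCast {x s i j : ℕ} (hx : x.Coprime s.factorial)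
    (hi : i < s) (hj : j < s) (hij : i ≠ j) : IsUnit ((i : ZMod x) - j) := by
  have aux : ∀ a b : ℕ, a < b → b < s → IsUnit ((b : ZMod x) - a) := by
    intro a b hab hb
    rw [← Nat.cast_sub hab.le, ZMod.isUnit_iff_coprime]
    exact (hx.coprime_dvd_right (Nat.dvd_factorial (by omega) (by omega))).symm
  rcases lt_or_gt_of_ne hij with h | h
  · rw [← neg_sub]
    exact (aux i j h hj).neg
  · exact aux j i h hi

/-- Rows of the first kind are the lines `y = a + b j` over `ZMod x`; a row `(i, α, β)` of the
second kind carries two intervals of length `w` in the `i`-th copy of `ZMod x`. -/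
def rowColoring (x w : ℕ) :
    ((ZMod x × ZMod x) ⊕ (Fin (2 * w) × Fin (x / w + 1) × Fin (x / w + 1))) → Fin (2 * w) →
      Fin (2 * w) × ZMod x
  | Sum.inl (a, b), j => (j, a + b * (j : ℕ))
  | Sum.inr (i, α, β), j =>
    (i, ((if (j : ℕ) < w then α * w + j else β * w + (j - w) : ℕ) : ZMod x))

lemma exists_rowColoring_eq {x w : ℕ} (hw : 0 < w) (hx0 : 0 < x)
    (hx : x.Coprime (2 * w).factorial) (c c' : Fin (2 * w) × ZMod x) :
    ∃ r j j', rowColoring x w r j = c ∧ rowColoring x w r j' = c' := by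
  have : NeZero x := ⟨hx0.ne'⟩
  obtain ⟨i, y⟩ := c
  obtain ⟨i', y'⟩ := c'
  by_cases h : i = i'
  · subst h
    have hlt : ∀ z : ZMod x, z.val / w < x / w + 1 := fun z =>
      Nat.lt_succ_of_le (Nat.div_le_div_right z.val_lt.le)
    have hm : ∀ z : ZMod x, z.val % w < w := fun z => Nat.mod_lt _ hw
    refine ⟨Sum.inr (i, ⟨_, hlt y⟩, ⟨_, hlt y'⟩), ⟨y.val % w, by have := hm y; omega⟩,
      ⟨w + y'.val % w, by have := hm y'; omega⟩, ?_, ?_⟩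
    · simp only [rowColoring, if_pos (hm y), Nat.div_add_mod']
      simp
    · simp only [rowColoring, if_neg (show ¬ w + y'.val % w < w by omega), Nat.add_sub_cancel_left,
        Nat.div_add_mod']
      simp
  · obtain ⟨u, hu⟩ := ZMod.isUnit_natCast_sub_natCast hx i.2 i'.2 (fun e => h (Fin.ext e))
    have hb : (y - y') * ↑u⁻¹ * ((i : ℕ) - (i' : ℕ) : ZMod x) = y - y' := by
      rw [← hu, mul_assoc, Units.inv_mul, mul_one]
    refine ⟨Sum.inl (y - (y - y') * ↑u⁻¹ * (i : ℕ), (y - y') * ↑u⁻¹), i, i', ?_, ?_⟩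
    · simp [rowColoring]
    · simp only [rowColoring, Prod.mk.injEq, true_and]
      linear_combination -hb

lemma SimpleGraph.le_hadwigerNumber_boxProd {V₁ V₂ : Type*} [Finite V₁] [Finite V₂]
    (G₁ : SimpleGraph V₁) (G₂ : SimpleGraph V₂) {x w : ℕ} (hw : 0 < w) (hx0 : 0 < x)
    (hx : x.Coprime (2 * w).factorial)
    (hl : x * x + 2 * w * ((x / w + 1) * (x / w + 1)) + 2 * w * x ≤ G₂.hadwigerNumber) :
    G₁.hadwigerNumber / (2 * w) * (2 * w * x) ≤ (G₁ □ G₂).hadwigerNumber := by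
  have : NeZero x := ⟨hx0.ne'⟩
  have : NeZero (2 * w) := ⟨by omega⟩
  have h₁ := top_isMinorOf_of_card_le_hadwigerNumber
    (U := Fin (G₁.hadwigerNumber / (2 * w)) × Fin (2 * w)) G₁
    (by simpa using Nat.div_mul_le_self _ _)
  have h₂ := top_isMinorOf_of_card_le_hadwigerNumber
    (U := ((ZMod x × ZMod x) ⊕ (Fin (2 * w) × Fin (x / w + 1) × Fin (x / w + 1))) ⊕
      (Fin (2 * w) × ZMod x)) G₂ (by simpa [ZMod.card] using hl)
  have h := ((top_prod_isMinorOf_boxProd (B := Fin (G₁.hadwigerNumber / (2 * w)))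
    (rowColoring x w) (exists_rowColoring_eq hw hx0 hx)).trans
      (h₁.boxProd h₂)).card_le_hadwigerNumber
  simpa [ZMod.card] using h

lemma rows_le_of_le_mul {ε z x w : ℝ} (hε0 : 0 < ε) (hε1 : ε < 1) (hw : 4 ≤ w * ε)
    (hw0 : 1 ≤ w) (hx : 0 ≤ x) (hxz : x ≤ (1 - ε / 3) * z) (hz1 : 1 ≤ z)
    (hz : 6 * (4 * w + 4) ≤ ε * z) :
    x * x + 2 * w * ((x / w + 1) * (x / w + 1)) + 2 * w * x ≤ z ^ 2 := by
  have e1 : 2 * w * ((x / w + 1) * (x / w + 1)) = 2 / w * x ^ 2 + 4 * x + 2 * w := by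
    field_simp
    ring
  have e2 : 2 / w ≤ ε / 2 := by
    rw [div_le_div_iff₀ (by linarith) (by norm_num)]
    linarith
  have e3 : 2 / w * x ^ 2 ≤ ε / 2 * x ^ 2 := by gcongr
  have e4 : x ^ 2 ≤ ((1 - ε / 3) * z) ^ 2 := by gcongr
  have e5 : (1 + ε / 2) * x ^ 2 ≤ (1 + ε / 2) * ((1 - ε / 3) * z) ^ 2 := by gcongr
  have e6 : (1 + ε / 2) * (1 - ε / 3) ^ 2 ≤ 1 - ε / 6 := by
    nlinarith [mul_pos hε0 hε0]
  have e7 : (1 + ε / 2) * ((1 - ε / 3) * z) ^ 2 ≤ (1 - ε / 6) * z ^ 2 := by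
    rw [mul_pow, ← mul_assoc]
    gcongr
  have e8 : x ≤ z := hxz.trans (by nlinarith)
  have e9 : (2 * w + 4) * x ≤ (2 * w + 4) * z := by gcongr
  have e10 : 2 * w ≤ 2 * w * z := by nlinarith
  have e11 : 6 * (4 * w + 4) * z ≤ ε * z * z := by gcongr
  nlinarith

theorem stmt_2 :
    ∀ ε : ℝ, 0 < ε → ∃ N : ℕ,
      ∀ (V₁ V₂ : Type) [Fintype V₁] [Fintype V₂]
        (G₁ : SimpleGraph V₁) (G₂ : SimpleGraph V₂) (h l : ℕ),
        G₁.hadwigerNumber = h → G₂.hadwigerNumber = l → l ≤ h → N ≤ l →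
        (1 - ε) * (h : ℝ) * Real.sqrt l ≤ ((G₁ □ G₂).hadwigerNumber : ℝ) := by
  intro ε hε0
  rcases le_or_gt 1 ε with hε1 | hε1
  · refine ⟨0, fun V₁ V₂ _ _ G₁ G₂ h l _ _ _ _ => ?_⟩
    have : (1 - ε) * ((h : ℝ) * Real.sqrt l) ≤ 0 :=
      mul_nonpos_of_nonpos_of_nonneg (by linarith) (by positivity)
    exact (by linarith : (1 - ε) * (h : ℝ) * Real.sqrt l ≤ 0).trans (Nat.cast_nonneg _)
  obtain ⟨w, hw⟩ := exists_nat_ge (4 / ε)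
  have hwε : 4 ≤ w * ε := (div_le_iff₀ hε0).1 hw
  have hw0 : 0 < w := by
    rcases Nat.eq_zero_or_pos w with rfl | h
    · norm_num at hwε
    · exact h
  have hw1 : (1 : ℝ) ≤ w := by exact_mod_cast hw0
  set S := (2 * w).factorial with hS
  have hS0 : 0 < S := Nat.factorial_pos _
  have hS1 : (1 : ℝ) ≤ S := by exact_mod_cast hS0
  obtain ⟨Z, hZ⟩ := exists_nat_ge ((6 * (4 * w + 4) + 4 * S) / ε)
  refine ⟨Z ^ 2, fun V₁ V₂ _ _ G₁ G₂ h l hh hl hlh hN => ?_⟩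
  set z := Real.sqrt l with hz
  have hz2 : z ^ 2 = l := Real.sq_sqrt (Nat.cast_nonneg _)
  have hZz : (Z : ℝ) ≤ z := Real.le_sqrt_of_sq_le (by exact_mod_cast hN)
  have hzε : 6 * (4 * w + 4) + 4 * S ≤ ε * z := by
    have := (div_le_iff₀ hε0).1 (hZ.trans hZz)
    linarith
  have hz1 : 1 ≤ z := by nlinarith
  have hzh : z ≤ h := by
    have : (l : ℝ) ≤ h := by exact_mod_cast hlh
    nlinarith
  set k := ⌊(1 - ε / 2) * z / S⌋₊ with hk
  have hSpos : (0 : ℝ) < S := by linarith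
  have hk1 : (k : ℝ) * S ≤ (1 - ε / 2) * z :=
    (le_div_iff₀ hSpos).1 (Nat.floor_le (div_nonneg (mul_nonneg (by linarith) (by linarith))
      hSpos.le))
  have hk2 : (1 - ε / 2) * z < (k + 1) * S := (div_lt_iff₀ hSpos).1 (Nat.lt_floor_add_one _)
  have hxc : (k * S + 1).Coprime (2 * w).factorial := by
    rw [← hS]
    simp
  have hxr : ((k * S + 1 : ℕ) : ℝ) = k * S + 1 := by push_cast; ring
  have hrows := rows_le_of_le_mul (x := ((k * S + 1 : ℕ) : ℝ)) (w := w) (z := z) hε0 hε1 hwε hw1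
    (Nat.cast_nonneg _) (by rw [hxr]; nlinarith) hz1 (by linarith)
  have hle := SimpleGraph.le_hadwigerNumber_boxProd G₁ G₂ (x := k * S + 1) hw0 (Nat.succ_pos _)
    hxc (by
      rw [hl]
      have hdiv : (((k * S + 1) / w : ℕ) : ℝ) ≤ ((k * S + 1 : ℕ) : ℝ) / w := Nat.cast_div_le
      rw [hz2] at hrows
      have : (((k * S + 1) * (k * S + 1) + 2 * w * (((k * S + 1) / w + 1) *
          ((k * S + 1) / w + 1)) + 2 * w * (k * S + 1) : ℕ) : ℝ) ≤ l := by
        refine le_trans ?_ hrows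
        rw [Nat.cast_add, Nat.cast_add, Nat.cast_mul, Nat.cast_mul, Nat.cast_mul (2 * w),
          Nat.cast_mul, Nat.cast_mul, Nat.cast_add ((k * S + 1) / w)]
        push_cast at hdiv ⊢
        gcongr
      exact_mod_cast this)
  rw [hh] at hle
  have hB : (h : ℝ) - 2 * w ≤ ((h / (2 * w) : ℕ) : ℝ) * (2 * w) := by
    have h1 : h < (h / (2 * w)) * (2 * w) + 2 * w := Nat.lt_div_mul_add (by omega)
    have h2 : (h : ℝ) < ((h / (2 * w) : ℕ) : ℝ) * (2 * w) + 2 * w := by exact_mod_cast h1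
    linarith
  have hle' : ((h / (2 * w) : ℕ) : ℝ) * (2 * w) * ((k * S + 1 : ℕ) : ℝ) ≤
      ((G₁ □ G₂).hadwigerNumber : ℝ) := by
    rw [mul_assoc]
    exact_mod_cast hle
  refine le_trans ?_ hle'
  have hh1 : (1 - ε / 4) * h ≤ ((h / (2 * w) : ℕ) : ℝ) * (2 * w) := by
    have : ε * z ≤ ε * h := by gcongr
    linarith
  have hx1 : (1 - 3 * ε / 4) * z ≤ ((k * S + 1 : ℕ) : ℝ) := by
    rw [hxr]
    linarith
  calc (1 - ε) * (h : ℝ) * z ≤ ((1 - ε / 4) * h) * ((1 - 3 * ε / 4) * z) := by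
        have : 0 ≤ ε ^ 2 * (h * z) := by positivity
        nlinarith
    _ ≤ _ := mul_le_mul hh1 hx1 (mul_nonneg (by linarith) (by linarith)) (by positivity)
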